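/- For every k ≥ 0, the spherical coefficient u_k of the cubic matrix model satisfies u_k = 8^k·Γ((3k+1)/2)/((k+1)!·Γ((k+1)/2)), where Γ is the real Gamma function; in particular u_0, u_1, u_2, u_3, u_4, u_5 = 1, 4, 40, 512, 7392, 114688. -/

import Mathlib

open Finset

open PowerSeries in
/-- A power series `F` with `F² = 1 + 8XF³` satisfies a linear differential equation of
second order. -/
theorem PowerSeries.derivative_eq_of_sq_eq_one_add_X_mul_cube (F : PowerSeries ℝ)
    (hF : F ^ 2 = 1 + 8 * X * F ^ 3) :
    X * d⁄dX ℝ (d⁄dX ℝ F) + 2 * d⁄dX ℝ F =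
      48 * (X * (9 * (X ^ 2 * d⁄dX ℝ (d⁄dX ℝ F)) + 27 * (X * d⁄dX ℝ F) + 5 * F)) + 8 := by
  have hF0 : F ≠ 0 := by
    rintro rfl
    simp at hF
  have ha : (1 - 12 * X * F : PowerSeries ℝ) ≠ 0 := fun h => by
    simpa using congrArg constantCoeff h
  have hnum (n : ℕ) [n.AtLeastTwo] : d⁄dX ℝ (OfNat.ofNat n : PowerSeries ℝ) = 0 :=
    (d⁄dX ℝ).map_natCast n
  have hD : d⁄dX ℝ F * (1 - 12 * X * F) = 4 * F ^ 2 := by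
    have h := congrArg (d⁄dX ℝ) hF
    simp only [map_add, Derivation.leibniz, derivative_pow, derivative_one, derivative_X, hnum,
      smul_eq_mul] at h
    have h2 : 2 * F * (d⁄dX ℝ F * (1 - 12 * X * F)) = 2 * F * (4 * F ^ 2) := by
      push_cast at h
      linear_combination h
    have h20 : (2 : PowerSeries ℝ) ≠ 0 := fun h => by
      simpa only [map_ofNat, map_zero, OfNat.ofNat_ne_zero] using
        congrArg (constantCoeff (R := ℝ)) h
    exact mul_left_cancel₀ (mul_ne_zero h20 hF0) h2
  have hE : d⁄dX ℝ (d⁄dX ℝ F) * (1 - 12 * X * F) =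
      20 * F * d⁄dX ℝ F + 12 * X * d⁄dX ℝ F ^ 2 := by
    have h := congrArg (d⁄dX ℝ) hD
    simp only [map_sub, Derivation.leibniz, derivative_pow, derivative_one, derivative_X, hnum,
      smul_eq_mul] at h
    push_cast at h
    linear_combination h
  generalize d⁄dX ℝ (d⁄dX ℝ F) = E at *
  generalize d⁄dX ℝ F = D at *
  refine mul_left_cancel₀ (pow_ne_zero 3 ha) ?_
  linear_combination X * (1 - 432 * X ^ 2) * ((1 - 12 * X * F) ^ 2 * hE +
    (20 * F * (1 - 12 * X * F) + 12 * X * (D * (1 - 12 * X * F) + 4 * F ^ 2)) * hD) +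
    (2 - 1296 * X ^ 2) * (1 - 12 * X * F) ^ 2 * hD + (8 - 48 * X * F) * hF

open PowerSeries in
theorem PowerSeries.coeff_recurrence_of_sq_eq_one_add_X_mul_cube (F : PowerSeries ℝ)
    (hF : F ^ 2 = 1 + 8 * X * F ^ 3) (k : ℕ) :
    ((k : ℝ) + 2) * (k + 3) * coeff (k + 2) F = 48 * (3 * k + 1) * (3 * k + 5) * coeff k F := by
  have hmul (n m : ℕ) [n.AtLeastTwo] (G : PowerSeries ℝ) :
      coeff m ((OfNat.ofNat n : PowerSeries ℝ) * G) = (OfNat.ofNat n : ℝ) * coeff m G := by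
    rw [← coeff_C_mul, map_ofNat]
  have h8 : coeff (k + 1) (8 : PowerSeries ℝ) = 0 := by
    rw [← map_ofNat (C (R := ℝ)) 8, coeff_C, if_neg k.succ_ne_zero]
  have h := congrArg (coeff (k + 1)) (derivative_eq_of_sq_eq_one_add_X_mul_cube F hF)
  rw [map_add, map_add, h8] at h
  rcases k with _ | _ | k <;>
  · simp [hmul, coeff_succ_X_mul, coeff_zero_X_mul, coeff_derivative, coeff_X_pow_mul',
      -coeff_zero_eq_constantCoeff] at h
    push_cast
    linear_combination h

open PowerSeries in
/-- The generating functions of the spherical coefficients, `U = 1 + 2XUV` and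
`V = 2U + XV²`, satisfy `U² = 1 + 8XU³`. -/
theorem cubic_spherical_generating_function (u v : ℕ → ℝ)
    (hu0 : u 0 = 1)
    (hu : ∀ k : ℕ, u (k + 1) = 2 * ∑ p ∈ Finset.range (k + 1), u (k - p) * v p)
    (hv : ∀ k : ℕ, v k = 2 * u k + ∑ p ∈ Finset.range k, v (k - 1 - p) * v p) :
    PowerSeries.mk u ^ 2 = 1 + 8 * X * PowerSeries.mk u ^ 3 := by
  have hconv (a : ℕ → ℝ) (k : ℕ) :
      coeff k (PowerSeries.mk a * PowerSeries.mk v) = ∑ p ∈ Finset.range (k + 1), a (k - p) * v p := by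
    rw [mul_comm, coeff_mul, Finset.Nat.sum_antidiagonal_eq_sum_range_succ_mk]
    simp [mul_comm]
  have hU : PowerSeries.mk u = 1 + C 2 * (X * (PowerSeries.mk u * PowerSeries.mk v)) := by
    ext (_ | k)
    · simp [hu0]
    · rw [map_add, coeff_C_mul, coeff_succ_X_mul, hconv, coeff_mk, hu k, coeff_one,
        if_neg k.succ_ne_zero, zero_add]
  have hV : PowerSeries.mk v = C 2 * PowerSeries.mk u + X * (PowerSeries.mk v * PowerSeries.mk v) := by
    ext (_ | k)
    · rw [map_add, coeff_C_mul, coeff_zero_X_mul, coeff_mk, coeff_mk, hv 0, sum_range_zero]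
    · rw [map_add, coeff_C_mul, coeff_succ_X_mul, hconv, coeff_mk, coeff_mk, hv (k + 1),
        Nat.add_sub_cancel]
  rw [map_ofNat] at hU hV
  generalize PowerSeries.mk u = U at *
  generalize PowerSeries.mk v = V at *
  have hS : U * (1 - 2 * X * V) = 1 := by linear_combination hU
  linear_combination 4 * X * U ^ 2 * hV + (U * (1 - 2 * X * V) + 1) * hS

/-- The closed form for the spherical coefficients `u_k`. -/
noncomputable def cubicSphericalClosedForm (k : ℕ) : ℝ :=
  8 ^ k * Real.Gamma ((3 * (k : ℝ) + 1) / 2) /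
    ((Nat.factorial (k + 1) : ℝ) * Real.Gamma (((k : ℝ) + 1) / 2))

theorem cubicSphericalClosedForm_recurrence (k : ℕ) :
    ((k : ℝ) + 2) * (k + 3) * cubicSphericalClosedForm (k + 2) =
      48 * (3 * k + 1) * (3 * k + 5) * cubicSphericalClosedForm k := by
  have hk : (0 : ℝ) ≤ k := k.cast_nonneg
  have hG : Real.Gamma (((k : ℝ) + 1) / 2) ≠ 0 := (Real.Gamma_pos_of_pos (by positivity)).ne'
  have h1 : Real.Gamma (((k + 2 : ℕ) + 1) / 2) = (k + 1) / 2 * Real.Gamma (((k : ℝ) + 1) / 2) := by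
    rw [← Real.Gamma_add_one (by positivity)]
    push_cast
    ring_nf
  have h2 : Real.Gamma ((3 * (k + 2 : ℕ) + 1) / 2) = (3 * k + 5) / 2 * ((3 * k + 3) / 2 *
      ((3 * k + 1) / 2 * Real.Gamma ((3 * (k : ℝ) + 1) / 2))) := by
    rw [← Real.Gamma_add_one (by positivity),
      show (3 * (k : ℝ) + 1) / 2 + 1 = (3 * k + 3) / 2 by ring,
      ← Real.Gamma_add_one (by positivity),
      show (3 * (k : ℝ) + 3) / 2 + 1 = (3 * k + 5) / 2 by ring,
      ← Real.Gamma_add_one (by positivity)]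
    push_cast
    ring_nf
  have hf : ((k + 1).factorial : ℝ) ≠ 0 := by positivity
  rw [cubicSphericalClosedForm, cubicSphericalClosedForm, h1, h2,
    Nat.factorial_succ (k + 2), Nat.factorial_succ (k + 1)]
  push_cast
  field_simp
  ring

/-- Closed form for the spherical coefficients `u_k` of the cubic matrix model:
`u_k = 8^k·Γ((3k+1)/2)/((k+1)!·Γ((k+1)/2))`; in particular `u_0,…,u_5 =
1, 4, 40, 512, 7392, 114688`. -/
theorem cubic_spherical_u_closed_form (u v : ℕ → ℤ)
    (hu0 : u 0 = 1)
    (hu : ∀ k : ℕ, u (k + 1) = 2 * ∑ p ∈ Finset.range (k + 1), u (k - p) * v p)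
    (hv : ∀ k : ℕ, v k = 2 * u k + ∑ p ∈ Finset.range k, v (k - 1 - p) * v p) :
    (∀ k : ℕ, (u k : ℝ) =
        8 ^ k * Real.Gamma ((3 * (k : ℝ) + 1) / 2) /
          ((Nat.factorial (k + 1) : ℝ) * Real.Gamma (((k : ℝ) + 1) / 2))) ∧
    u 0 = 1 ∧ u 1 = 4 ∧ u 2 = 40 ∧ u 3 = 512 ∧ u 4 = 7392 ∧ u 5 = 114688 := by
  have hv0 : v 0 = 2 := by rw [hv 0, sum_range_zero, hu0]; rfl
  have hu1 : u 1 = 4 := by rw [hu 0]; simp [hv0, hu0]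
  have hrec (k : ℕ) :
      ((k : ℝ) + 2) * (k + 3) * u (k + 2) = 48 * (3 * k + 1) * (3 * k + 5) * u k := by
    have hU := cubic_spherical_generating_function (fun k => (u k : ℝ)) (fun k => (v k : ℝ))
      (by exact_mod_cast hu0) (fun k => by exact_mod_cast hu k) (fun k => by exact_mod_cast hv k)
    simpa using PowerSeries.coeff_recurrence_of_sq_eq_one_add_X_mul_cube _ hU k
  have hrecZ (k : ℕ) :
      ((k : ℤ) + 2) * (k + 3) * u (k + 2) = 48 * (3 * k + 1) * (3 * k + 5) * u k := by
    exact_mod_cast hrec k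
  have hclosed (k : ℕ) : (u k : ℝ) = cubicSphericalClosedForm k := by
    induction k using Nat.twoStepInduction with
    | zero =>
      have hG : Real.Gamma (1 / 2) ≠ 0 := (Real.Gamma_pos_of_pos (by norm_num)).ne'
      rw [one_div] at hG
      simp [cubicSphericalClosedForm, hu0, hG]
    | one =>
      norm_num [cubicSphericalClosedForm, hu1, Real.Gamma_two, Nat.factorial]
    | more k ih _ =>
      refine mul_left_cancel₀ (show ((k : ℝ) + 2) * (k + 3) ≠ 0 by positivity) ?_
      rw [hrec, cubicSphericalClosedForm_recurrence, ih]
  have h2 := hrecZ 0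
  have h3 := hrecZ 1
  have h4 := hrecZ 2
  have h5 := hrecZ 3
  norm_num [hu0, hu1] at h2 h3 h4 h5
  exact ⟨hclosed, hu0, hu1, by lia, by lia, by lia, by lia⟩
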